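/- Let s be a finite-dimensional semisimple Lie algebra over an algebraically closed field k of characteristic 0, with root lattice Q and dominant integral weights P⁺, and let V be a faithful irreducible finite-dimensional s-module with highest weight ν. Let ∼ be the equivalence relation on P⁺ × k generated by: (λ,a) ∼ (μ,a+1) whenever there exist irreducible finite-dimensional s-modules M_λ and M_μ with highest weights λ and μ such that Hom_s(V ⊗ M_λ, M_μ) ≠ 0. Then for all (λ,a), (μ,b) ∈ P⁺ × k, one has (λ,a) ∼ (μ,b) if and only if there exists an integer n ∈ ℤ with μ − λ − nν ∈ Q and b = a + n. -/

import Mathlib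

open scoped TensorProduct

universe u

variable (k s : Type u) [Field k] [IsAlgClosed k] [CharZero k]
  [LieRing s] [LieAlgebra k s] [FiniteDimensional k s] [LieAlgebra.IsSemisimple k s]
variable (H : LieSubalgebra k s) [H.IsCartanSubalgebra]

/-- The weight space of a module `M` for a linear functional `χ` on the Cartan subalgebra
`H`: the set of `m` with `x • m = χ(x) m` for all `x ∈ H`. -/
def wtSpace (M : Type u) [AddCommGroup M] [Module k M] [LieRingModule s M]
    [LieModule k s M] (χ : Module.Dual k ↥H) : Submodule k M where
  carrier := {m | ∀ x : ↥H, ⁅(x : s), m⁆ = χ x • m}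
  add_mem' := by intro a b ha hb x; rw [lie_add, ha x, hb x, smul_add]
  zero_mem' := by intro x; simp
  smul_mem' := by intro c m hm x; rw [lie_smul, hm x, smul_comm]

/-- `χ` is a weight of `M` if the corresponding weight space is nonzero. -/
def IsWeightOf (M : Type u) [AddCommGroup M] [Module k M] [LieRingModule s M]
    [LieModule k s M] (χ : Module.Dual k ↥H) : Prop :=
  wtSpace k s H M χ ≠ ⊥

/-- The roots of `s` relative to `H`: the nonzero weights of the adjoint module. -/
def IsRoot (χ : Module.Dual k ↥H) : Prop :=
  χ ≠ 0 ∧ IsWeightOf k s H s χ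

/-- The root lattice `Q`: the additive subgroup of `(H)^*` generated by the roots. -/
def rootLattice : AddSubgroup (Module.Dual k ↥H) :=
  AddSubgroup.closure {χ | IsRoot k s H χ}

/-- A positive system of roots: a set of roots such that exactly one of `±α` is positive for
every root `α`, and which is closed under addition of roots. -/
def IsPositiveSystem (Pos : Set (Module.Dual k ↥H)) : Prop :=
  (∀ χ ∈ Pos, IsRoot k s H χ) ∧
  (∀ χ, IsRoot k s H χ → (χ ∈ Pos ↔ ¬ (-χ ∈ Pos))) ∧
  (∀ α ∈ Pos, ∀ β ∈ Pos, IsRoot k s H (α + β) → α + β ∈ Pos)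

/-- `lam` is the highest weight of the module `M` relative to the positive system `Pos`:
it is a weight, and every weight of `M` is obtained from it by subtracting positive roots. -/
def IsHighestWeightOf (Pos : Set (Module.Dual k ↥H))
    (M : Type u) [AddCommGroup M] [Module k M] [LieRingModule s M] [LieModule k s M]
    (lam : Module.Dual k ↥H) : Prop :=
  IsWeightOf k s H M lam ∧
    ∀ χ, IsWeightOf k s H M χ → lam - χ ∈ AddSubmonoid.closure Pos

/-- `σ` is the reflection in the Weyl group attached to a root `α`: an involution sending
`α` to `-α`, moving every functional along `α` only, and preserving the set of roots. -/
def IsWeylReflection (σ : Module.Dual k ↥H ≃ₗ[k] Module.Dual k ↥H) : Prop :=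
  ∃ α, IsRoot k s H α ∧ σ α = -α ∧ σ * σ = 1 ∧
    (∀ χ, ∃ c : k, χ - σ χ = c • α) ∧ (∀ β, IsRoot k s H β → IsRoot k s H (σ β))

/-- The Weyl group `W(s)`, as the group of automorphisms of `(H)^*` generated by the
reflections in the roots. -/
def weylGroup : Subgroup (Module.Dual k ↥H ≃ₗ[k] Module.Dual k ↥H) :=
  Subgroup.closure {σ | IsWeylReflection k s H σ}

/-- A bundled Lie module over `s`. -/
structure LieModuleBundle : Type (u + 1) where
  carrier : Type u
  [addCommGroup : AddCommGroup carrier]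
  [module : Module k carrier]
  [lieRingModule : LieRingModule s carrier]
  [lieModule : LieModule k s carrier]

attribute [instance] LieModuleBundle.addCommGroup LieModuleBundle.module
  LieModuleBundle.lieRingModule LieModuleBundle.lieModule

/-- `lam` is a dominant integral weight (`lam ∈ P⁺`): it is the highest weight of some
irreducible finite-dimensional `s`-module. -/
def IsDominant (Pos : Set (Module.Dual k ↥H)) (lam : Module.Dual k ↥H) : Prop :=
  ∃ B : LieModuleBundle k s, LieModule.IsIrreducible k s B.carrier ∧
    FiniteDimensional k B.carrier ∧ IsHighestWeightOf k s H Pos B.carrier lam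

section

variable (Pos : Set (Module.Dual k ↥H))
variable (V : Type u) [AddCommGroup V] [Module k V] [LieRingModule s V] [LieModule k s V]

/-- The generating relation on `P⁺ × k`: `(lam, a)` is related to `(mu, a+1)` whenever
`Hom_s(V ⊗ M_lam, M_mu) ≠ 0` for irreducible finite-dimensional modules `M_lam`, `M_mu`
of highest weights `lam`, `mu`. -/
def hwStep (p q : Module.Dual k ↥H × k) : Prop :=
  q.2 = p.2 + 1 ∧
    ∃ B C : LieModuleBundle k s,
      LieModule.IsIrreducible k s B.carrier ∧ FiniteDimensional k B.carrier ∧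
      LieModule.IsIrreducible k s C.carrier ∧ FiniteDimensional k C.carrier ∧
      IsHighestWeightOf k s H Pos B.carrier p.1 ∧
      IsHighestWeightOf k s H Pos C.carrier q.1 ∧
      ∃ f : (V ⊗[k] B.carrier) →ₗ⁅k,s⁆ C.carrier, f ≠ 0

end

set_option linter.unusedSectionVars false

theorem lie_le_of_semisimple : ⁅(⊤ : LieIdeal k s), (⊤ : LieIdeal k s)⁆ = ⊤ := by
  rw [eq_top_iff]
  refine LieAlgebra.IsSemisimple.sSup_atoms_eq_top (R := k) (L := s) ▸ sSup_le fun I hI ↦ ?_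
  rw [← lie_eq_self_of_isAtom_of_nonabelian I hI
    (LieAlgebra.IsSemisimple.non_abelian_of_isAtom I hI)]
  exact LieSubmodule.mono_lie (le_sSup hI) (le_sSup hI)

section Cohomology

variable {k s}
variable {M : Type u} [AddCommGroup M] [Module k M] [LieRingModule s M] [LieModule k s M]

/-- A linear map on a semisimple Lie algebra that vanishes on brackets is zero. -/
theorem linearMap_eq_zero_of_lie (d : s →ₗ[k] M) (hd : ∀ x y : s, d ⁅x, y⁆ = 0) : d = 0 := by
  have h : LieSubmodule.toSubmodule ⁅(⊤ : LieIdeal k s), (⊤ : LieIdeal k s)⁆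
      ≤ LinearMap.ker d := by
    rw [LieSubmodule.lieIdeal_oper_eq_linear_span, Submodule.span_le]
    rintro _ ⟨x, y, rfl⟩
    exact hd _ _
  rw [lie_le_of_semisimple] at h
  ext x
  exact h (x := x) trivial

theorem sum_dualBasis_lie (I : LieIdeal k s) {B : LinearMap.BilinForm k I} (hB : B.Nondegenerate)
    (hsymm : B.IsSymm) (hinv : ∀ (y : s) (u v : I), B ⁅y, u⁆ v = -B u ⁅y, v⁆)
    {ι : Type*} [Fintype ι] [DecidableEq ι] (b : Module.Basis ι k I)
    {A : Type*} [AddCommGroup A] [Module k A] (F : I →ₗ[k] I →ₗ[k] A) (y : s) :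
    ∑ i, (F ⁅y, b i⁆ (B.dualBasis hB b i) + F (b i) ⁅y, B.dualBasis hB b i⁆) = 0 := by
  set b' := B.dualBasis hB b with hb'
  have h1 (u : I) : u = ∑ j, B (b' j) u • b j := by
    conv_lhs => rw [← b.sum_repr u]
    refine Finset.sum_congr rfl fun j _ ↦ ?_
    congr 1
    have := LinearMap.BilinForm.dualBasis_repr_apply hB b' u j
    rw [hb', LinearMap.BilinForm.dualBasis_dualBasis hB hsymm] at this
    rw [this, hsymm.eq]
  have h2 (u : I) : u = ∑ j, B u (b j) • b' j := by
    conv_lhs => rw [← b'.sum_repr u]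
    simp [hb']
  have e1 : ∑ i, F ⁅y, b i⁆ (b' i) = ∑ i, ∑ j, B (b' j) ⁅y, b i⁆ • F (b j) (b' i) := by
    refine Finset.sum_congr rfl fun i _ ↦ ?_
    conv_lhs => rw [h1 ⁅y, b i⁆]
    simp
  have e2 : ∑ i, F (b i) ⁅y, b' i⁆ = ∑ i, ∑ j, B ⁅y, b' i⁆ (b j) • F (b i) (b' j) := by
    refine Finset.sum_congr rfl fun i _ ↦ ?_
    conv_lhs => rw [h2 ⁅y, b' i⁆]
    simp
  rw [Finset.sum_add_distrib, e1, e2, Finset.sum_comm, ← Finset.sum_add_distrib]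
  refine Finset.sum_eq_zero fun i _ ↦ ?_
  rw [← Finset.sum_add_distrib]
  refine Finset.sum_eq_zero fun j _ ↦ ?_
  rw [hinv]
  simp

/-- The elements of an irreducible module killed by an ideal form a submodule. -/
theorem LieModule.IsIrreducible.lie_eq_zero_of_ideal [LieModule.IsIrreducible k s M]
    (I : LieIdeal k s) {m : M} (hm : m ≠ 0) (h : ∀ x ∈ I, ⁅x, m⁆ = 0) :
    ∀ x ∈ I, ∀ m : M, ⁅x, m⁆ = 0 := by
  let N : LieSubmodule k s M :=
    { carrier := {m | ∀ x ∈ I, ⁅x, m⁆ = 0}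
      add_mem' := fun ha hb x hx ↦ by rw [lie_add, ha x hx, hb x hx, add_zero]
      zero_mem' := fun x _ ↦ lie_zero x
      smul_mem' := fun c m hm x hx ↦ by rw [lie_smul, hm x hx, smul_zero]
      lie_mem := fun {y m} hm x hx ↦ by
        rw [leibniz_lie, hm x hx, lie_zero, add_zero]
        exact hm _ (lie_mem_left k s I x y hx) }
  have hN : N = ⊤ := (eq_bot_or_eq_top N).resolve_left fun hN ↦ hm <| by
    have : m ∈ N := h
    simpa [hN] using this
  intro x hx m
  have : m ∈ N := hN ▸ LieSubmodule.mem_top m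
  exact this x hx

theorem traceForm_restrict_nondegenerate [FiniteDimensional k M] [LieModule.IsIrreducible k s M]
    (I : LieIdeal k s) (hI : IsAtom I) (h : ∃ x ∈ I, ∃ m : M, ⁅x, m⁆ ≠ 0) :
    (LieModule.traceForm k I M).Nondegenerate := by
  have hM : Nontrivial M := (LieSubmodule.nontrivial_iff k s M).mp inferInstance
  have hsymm := LieModule.traceForm_isSymm k I M
  refine (LinearMap.IsRefl.nondegenerate_iff_separatingLeft hsymm.isRefl).mpr ?_
  let K : LieIdeal k s :=
    { carrier := {x | x ∈ I ∧ ∀ y ∈ I, LieModule.traceForm k s M x y = 0}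
      add_mem' := fun ha hb ↦ ⟨I.add_mem ha.1 hb.1, fun y hy ↦ by
        simp [ha.2 y hy, hb.2 y hy]⟩
      zero_mem' := ⟨I.zero_mem, by simp⟩
      smul_mem' := fun c m hm ↦ ⟨I.smul_mem c hm.1, fun y hy ↦ by simp [hm.2 y hy]⟩
      lie_mem := fun {y m} hm ↦ ⟨I.lie_mem hm.1, fun z hz ↦ by
        rw [LieModule.traceForm_apply_lie_apply', hm.2 _ (I.lie_mem hz), neg_zero]⟩ }
  have hKI : K ≤ I := fun x hx ↦ hx.1
  rcases hI.le_iff.mp hKI with hK | hK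
  · rintro ⟨x, hx⟩ h0
    have : x ∈ K := ⟨hx, fun y hy ↦ h0 ⟨y, hy⟩⟩
    rw [hK, LieSubmodule.mem_bot] at this
    exact Subtype.ext this
  · exfalso
    have h0 : LieModule.traceForm k I M = 0 := by
      ext ⟨x, hx⟩ ⟨y, hy⟩
      rw [← hK] at hx
      exact hx.2 y hy
    have hnil := LieModule.isNilpotent_derivedSeries_of_traceForm_eq_zero h0
    have := LieAlgebra.IsSemisimple.isSimple_of_isAtom I hI
    have hD : LieAlgebra.derivedSeries k I 1 = ⊤ := by
      refine (LieAlgebra.IsSimple.eq_bot_or_eq_top _).resolve_left fun hb ↦ ?_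
      refine LieAlgebra.IsSimple.non_abelian (R := k) (L := I) ?_
      rw [LieAlgebra.derivedSeries_def, ← LieAlgebra.abelian_iff_derived_one_eq_bot] at hb
      exact (lie_abelian_iff_equiv_lie_abelian LieIdeal.topEquiv).mp hb
    rw [hD] at hnil
    have hnil' : LieModule.IsNilpotent I M := by
      refine (Equiv.lieModule_isNilpotent_iff (R := k) LieIdeal.topEquiv (1 : M ≃ₗ[k] M)
        fun _ _ ↦ rfl).mp hnil
    have := LieModule.nontrivial_max_triv_of_isNilpotent k I M
    obtain ⟨⟨m, hm⟩, hm0⟩ := exists_ne (0 : LieModule.maxTrivSubmodule k I M)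
    obtain ⟨x, hx, m', hm'⟩ := h
    refine hm' (LieModule.IsIrreducible.lie_eq_zero_of_ideal I (m := m) ?_ ?_ x hx m')
    · simpa using hm0
    · intro y hy
      exact (LieModule.mem_maxTrivSubmodule k I M m).mp hm ⟨y, hy⟩

end Cohomology

section Cohomology

variable {k s}

theorem exists_eq_lie_of_cocycle_of_isIrreducible
    {M : Type u} [AddCommGroup M] [Module k M] [LieRingModule s M] [LieModule k s M]
    [FiniteDimensional k M] [LieModule.IsIrreducible k s M]
    (d : s →ₗ[k] M) (hd : ∀ x y : s, d ⁅x, y⁆ = ⁅x, d y⁆ - ⁅y, d x⁆) :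
    ∃ m : M, ∀ x : s, d x = ⁅x, m⁆ := by
  classical
  by_cases htriv : ∀ I : LieIdeal k s, IsAtom I → ∀ x ∈ I, ∀ m : M, ⁅x, m⁆ = 0
  · have htop : (⊤ : LieIdeal k s) ≤ LieModule.ker k s M := by
      rw [← LieAlgebra.IsSemisimple.sSup_atoms_eq_top]
      exact sSup_le fun I hI x hx ↦ (LieModule.mem_ker k s M x).mpr fun m ↦ htriv I hI x hx m
    have hz (x : s) (m : M) : ⁅x, m⁆ = 0 :=
      (LieModule.mem_ker k s M x).mp (htop (LieSubmodule.mem_top x)) m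
    refine ⟨0, fun x ↦ ?_⟩
    rw [linearMap_eq_zero_of_lie d fun x y ↦ by rw [hd, hz, hz, sub_zero], lie_zero,
      LinearMap.zero_apply]
  push Not at htriv
  obtain ⟨I, hI, h⟩ := htriv
  have hB := traceForm_restrict_nondegenerate (M := M) I hI h
  set B : LinearMap.BilinForm k I := LieModule.traceForm k I M with hBdef
  have hsymm : B.IsSymm := ⟨fun x y ↦ LieModule.traceForm_comm k I M x y⟩
  have hinv (y : s) (u v : I) : B ⁅y, u⁆ v = -B u ⁅y, v⁆ :=
    LieModule.traceForm_apply_lie_apply' k s M y u v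
  let b := Module.finBasis k I
  let b' := B.dualBasis hB b
  let φ : I →ₗ[k] Module.End k M := (LieModule.toEnd k s M : s →ₗ[k] Module.End k M) ∘ₗ
    (I : Submodule k s).subtype
  let Ω : Module.End k M := ∑ i, φ (b i) ∘ₗ φ (b' i)
  have hΩ (m : M) : Ω m = ∑ i, ⁅(b i : s), ⁅(b' i : s), m⁆⁆ := by
    simp [Ω, φ]; rfl
  have hcomm (y : s) (m : M) : Ω ⁅y, m⁆ = ⁅y, Ω m⁆ := by
    let F : I →ₗ[k] I →ₗ[k] M := LinearMap.mk₂ k (fun u v ↦ ⁅(u : s), ⁅(v : s), m⁆⁆)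
      (by simp) (by simp) (by simp) (by simp)
    have := sum_dualBasis_lie I hB hsymm hinv b F y
    rw [hΩ, hΩ, lie_sum, ← sub_eq_zero, ← neg_eq_zero, ← this, ← Finset.sum_sub_distrib,
      ← Finset.sum_neg_distrib]
    refine Finset.sum_congr rfl fun i _ ↦ ?_
    simp only [F, LinearMap.mk₂_apply, LieSubmodule.coe_bracket, lie_lie, b', lie_sub]
    abel
  have htr : LinearMap.trace k M Ω = (Module.finrank k I : k) := by
    have : ∀ i, LinearMap.trace k M (φ (b i) ∘ₗ φ (b' i)) = 1 := fun i ↦ by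
      have := LinearMap.BilinForm.apply_dualBasis_right hB hsymm b i i
      rw [if_pos rfl] at this
      exact this
    simp [Ω, this]
  have hI0 : (Module.finrank k I : k) ≠ 0 := by
    have : Nontrivial I := (LieSubmodule.nontrivial_iff_ne_bot k s _).mpr hI.1
    exact_mod_cast (Module.finrank_pos (R := k) (M := I)).ne'
  let K : LieSubmodule k s M :=
    { LinearMap.ker Ω with
      lie_mem := fun {y m} hm ↦ by
        have hm : Ω m = 0 := hm
        show Ω ⁅y, m⁆ = 0
        rw [hcomm, hm, lie_zero] }
  have hK : K = ⊥ := (eq_bot_or_eq_top K).resolve_right fun hK ↦ hI0 <| by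
    rw [← htr]
    have : Ω = 0 := by
      ext m
      have : m ∈ K := hK ▸ LieSubmodule.mem_top m
      exact this
    rw [this, map_zero]
  have hinj : Function.Injective Ω := by
    rw [← LinearMap.ker_eq_bot, eq_bot_iff]
    intro m hm
    have : m ∈ K := hm
    simpa [hK] using this
  have hsurj := LinearMap.injective_iff_surjective.mp hinj
  obtain ⟨m, hm⟩ := hsurj (∑ i, ⁅(b i : s), d (b' i : s)⁆)
  refine ⟨m, fun y ↦ hinj ?_⟩
  rw [hcomm, hm, hΩ]
  let F : I →ₗ[k] I →ₗ[k] M := LinearMap.mk₂ k (fun u v ↦ ⁅(u : s), d (v : s)⁆)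
      (by simp) (by simp) (by simp) (by simp)
  have := sum_dualBasis_lie I hB hsymm hinv b F y
  rw [lie_sum, ← sub_eq_zero, ← neg_eq_zero, ← this, ← Finset.sum_sub_distrib,
    ← Finset.sum_neg_distrib]
  refine Finset.sum_congr rfl fun i _ ↦ ?_
  simp only [F, LinearMap.mk₂_apply, LieSubmodule.coe_bracket, lie_lie, b', hd, lie_sub]
  abel

/-- Whitehead's first lemma: every 1-cocycle of a semisimple Lie algebra is inner. -/
theorem exists_eq_lie_of_cocycle (n : ℕ)
    (M : Type u) [AddCommGroup M] [Module k M] [LieRingModule s M] [LieModule k s M]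
    [FiniteDimensional k M] (hn : Module.finrank k M = n)
    (d : s →ₗ[k] M) (hd : ∀ x y : s, d ⁅x, y⁆ = ⁅x, d y⁆ - ⁅y, d x⁆) :
    ∃ m : M, ∀ x : s, d x = ⁅x, m⁆ := by
  induction n using Nat.strong_induction_on generalizing M with
  | _ n ih =>
  by_cases hN : ∃ N : LieSubmodule k s M, N ≠ ⊥ ∧ N ≠ ⊤
  · obtain ⟨N, hN0, hN1⟩ := hN
    have hlt : Module.finrank k N < n := hn ▸ Submodule.finrank_lt (s := (N : Submodule k M))
      (by simpa [lt_top_iff_ne_top] using hN1)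
    have hpos : 0 < Module.finrank k N := by
      have : Nontrivial N := (LieSubmodule.nontrivial_iff_ne_bot k s _).mpr hN0
      exact Module.finrank_pos
    have hadd := Submodule.finrank_quotient_add_finrank (N : Submodule k M)
    have hlt' : Module.finrank k (M ⧸ N) < n := by
      change Module.finrank k (M ⧸ (N : Submodule k M)) < n
      change _ + Module.finrank k N = _ at hadd
      omega
    have : FiniteDimensional k (M ⧸ N) :=
      inferInstanceAs (FiniteDimensional k (M ⧸ (N : Submodule k M)))
    obtain ⟨m', hm'⟩ := ih _ hlt' (M ⧸ N) rfl
      ((LieSubmodule.Quotient.mk' N : M →ₗ[k] M ⧸ N) ∘ₗ d) fun x y ↦ by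
        rw [LinearMap.comp_apply, hd, map_sub]
        exact congrArg₂ _ ((LieSubmodule.Quotient.mk' N).map_lie x _)
          ((LieSubmodule.Quotient.mk' N).map_lie y _)
    obtain ⟨m, rfl⟩ := LieSubmodule.Quotient.surjective_mk' N m'
    have hmem (x : s) : d x - ⁅x, m⁆ ∈ N := by
      rw [← LieSubmodule.Quotient.mk_eq_zero, map_sub, LieModuleHom.map_lie, sub_eq_zero]
      exact hm' x
    let d' : s →ₗ[k] N := LinearMap.codRestrict (N : Submodule k M)
      (d - (LieModule.toEnd k s M : s →ₗ[k] Module.End k M).flip m) hmem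
    have hd' (x : s) : (d' x : M) = d x - ⁅x, m⁆ := rfl
    obtain ⟨m₁, hm₁⟩ := ih _ hlt N rfl d' fun x y ↦ by
        ext
        simp only [hd', hd, LieSubmodule.coe_sub, LieSubmodule.coe_bracket, lie_sub, lie_lie]
        abel
    refine ⟨m + m₁, fun x ↦ ?_⟩
    have := congrArg Subtype.val (hm₁ x)
    rw [hd', LieSubmodule.coe_bracket] at this
    rw [lie_add, ← this]
    abel
  · push Not at hN
    rcases subsingleton_or_nontrivial M with hM | hM
    · exact ⟨0, fun x ↦ Subsingleton.elim _ _⟩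
    · have : LieModule.IsIrreducible k s M := LieModule.IsIrreducible.mk hN
      exact exists_eq_lie_of_cocycle_of_isIrreducible d hd

end Cohomology

section CompleteReducibility

variable {k s}

/-- Every injective morphism of finite-dimensional modules over a semisimple Lie algebra
splits. -/
theorem LieModuleHom.exists_leftInverse
    {N M : Type u} [AddCommGroup M] [Module k M] [LieRingModule s M] [LieModule k s M]
    [AddCommGroup N] [Module k N] [LieRingModule s N] [LieModule k s N]
    [FiniteDimensional k M] (j : N →ₗ⁅k,s⁆ M) (hj : Function.Injective j) :
    ∃ p : M →ₗ⁅k,s⁆ N, ∀ n, p (j n) = n := by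
  have : FiniteDimensional k N := FiniteDimensional.of_injective (j : N →ₗ[k] M) hj
  obtain ⟨π, hπ⟩ := LinearMap.exists_leftInverse_of_injective (j : N →ₗ[k] M)
    (LinearMap.ker_eq_bot.mpr hj)
  replace hπ (n : N) : π (j n) = n := LinearMap.congr_fun hπ n
  let W : LieSubmodule k s (M →ₗ[k] N) :=
    { carrier := {f | ∀ n, f (j n) = 0}
      add_mem' := fun ha hb n ↦ by rw [LinearMap.add_apply, ha n, hb n, add_zero]
      zero_mem' := fun n ↦ rfl
      smul_mem' := fun c f hf n ↦ by rw [LinearMap.smul_apply, hf n, smul_zero]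
      lie_mem := fun {x f} hf n ↦ by
        have hf : ∀ n, f (j n) = 0 := hf
        rw [LieHom.lie_apply, ← LieModuleHom.map_lie, hf, hf, lie_zero, sub_zero] }
  let d : s →ₗ[k] W := LinearMap.codRestrict (W : Submodule k (M →ₗ[k] N))
    ((LieModule.toEnd k s (M →ₗ[k] N) : s →ₗ[k] Module.End k (M →ₗ[k] N)).flip π)
    fun x n ↦ by
      show ⁅x, π⁆ (j n) = 0
      rw [LieHom.lie_apply, ← LieModuleHom.map_lie, hπ, hπ, sub_self]
  have hd (x : s) : (d x : M →ₗ[k] N) = ⁅x, π⁆ := rfl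
  obtain ⟨f, hf⟩ := exists_eq_lie_of_cocycle _ W rfl d fun x y ↦ by
    ext1
    simp only [hd, LieSubmodule.coe_sub, LieSubmodule.coe_bracket, lie_lie]
  refine ⟨{ π - (f : M →ₗ[k] N) with map_lie' := fun {x m} ↦ ?_ }, fun n ↦ ?_⟩
  · have h := LinearMap.congr_fun (congrArg Subtype.val (hf x)) m
    rw [hd, LieSubmodule.coe_bracket, LieHom.lie_apply, LieHom.lie_apply] at h
    show π ⁅x, m⁆ - (f : M →ₗ[k] N) ⁅x, m⁆ = ⁅x, π m - (f : M →ₗ[k] N) m⁆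
    rw [lie_sub, sub_eq_sub_iff_sub_eq_sub, ← neg_inj, neg_sub, neg_sub]
    rw [h]
  · show π (j n) - (f : M →ₗ[k] N) (j n) = n
    rw [hπ, f.2 n, sub_zero]

/-- The pair `(i, p)` exhibits `B` as an irreducible finite-dimensional direct summand
of `X`. -/
structure IsIrreducibleSummand {X : Type u} [AddCommGroup X] [Module k X] [LieRingModule s X]
    [LieModule k s X] (B : LieModuleBundle k s)
    (i : B.carrier →ₗ⁅k,s⁆ X) (p : X →ₗ⁅k,s⁆ B.carrier) : Prop where
  irreducible : LieModule.IsIrreducible k s B.carrier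
  finiteDimensional : FiniteDimensional k B.carrier
  leftInverse : ∀ t, p (i t) = t

/-- A finite-dimensional module is the sum of its irreducible direct summands. -/
theorem mem_of_forall_irreducibleSummand (n : ℕ)
    (X : Type u) [AddCommGroup X] [Module k X] [LieRingModule s X] [LieModule k s X]
    [FiniteDimensional k X] (hn : Module.finrank k X = n) (W : Submodule k X) (x : X)
    (h : ∀ (B : LieModuleBundle k s) (i : B.carrier →ₗ⁅k,s⁆ X) (p : X →ₗ⁅k,s⁆ B.carrier),
      IsIrreducibleSummand B i p → i (p x) ∈ W) : x ∈ W := by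
  induction n using Nat.strong_induction_on generalizing X with
  | _ n ih =>
  by_cases hN : ∃ N : LieSubmodule k s X, N ≠ ⊥ ∧ N ≠ ⊤
  · obtain ⟨N, hN0, hN1⟩ := hN
    obtain ⟨p, hp⟩ := LieModuleHom.exists_leftInverse N.incl Subtype.val_injective
    obtain ⟨q, hq⟩ := LieModuleHom.exists_leftInverse p.ker.incl Subtype.val_injective
    have key (K : LieSubmodule k s X) (hK : K ≠ ⊤) (r : X →ₗ⁅k,s⁆ K) (hr : ∀ n, r (K.incl n) = n)
        (y : X)
        (h : ∀ (B : LieModuleBundle k s) (i : B.carrier →ₗ⁅k,s⁆ X) (p : X →ₗ⁅k,s⁆ B.carrier),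
          IsIrreducibleSummand B i p → i (p y) ∈ W) : (r y : X) ∈ W := by
      refine ih _ (hn ▸ Submodule.finrank_lt (s := (K : Submodule k X))
        (by simpa [lt_top_iff_ne_top] using hK)) K rfl
        (W.comap (K.incl : K →ₗ[k] X)) (r y) fun B i p' hB ↦ ?_
      exact h B (K.incl.comp i) (p'.comp r) ⟨hB.1, hB.2, fun t ↦ by
        show p' (r (K.incl (i t))) = t
        rw [hr, hB.3]⟩
    have hker : p.ker ≠ ⊤ := fun hk ↦ hN0 <| by
      rw [eq_bot_iff]
      intro y hy
      have h1 : y ∈ p.ker := hk ▸ LieSubmodule.mem_top y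
      have h2 := hp ⟨y, hy⟩
      rw [LieModuleHom.mem_ker] at h1
      have h3 : p y = ⟨y, hy⟩ := h2
      rw [h1] at h3
      exact (congrArg Subtype.val h3).symm
    have h1 := key N hN1 p hp x h
    have h2 : x - p x ∈ p.ker := by
      rw [LieModuleHom.mem_ker, map_sub, sub_eq_zero]
      exact (hp (p x)).symm
    have h3 : ((q (x - p x) : p.ker) : X) = x - p x :=
      congrArg Subtype.val (hq ⟨x - p x, h2⟩)
    have h4 : x - p x ∈ W := by
      have hid : ∃ r : X →ₗ⁅k,s⁆ p.ker, (∀ n, r (p.ker.incl n) = n) ∧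
          ((r x : p.ker) : X) = x - p x := by
        refine ⟨q.comp (LieModuleHom.id - N.incl.comp p), fun n ↦ ?_, ?_⟩
        · show q ((n : X) - p n) = n
          rw [LieModuleHom.mem_ker.mp n.2, ZeroMemClass.coe_zero, sub_zero]
          exact hq n
        · exact h3
      obtain ⟨r, hr, hrx⟩ := hid
      rw [← hrx]
      exact key p.ker hker r hr x h
    simpa using W.add_mem h1 h4
  · push Not at hN
    rcases subsingleton_or_nontrivial X with hX | hX
    · rw [Subsingleton.elim x 0]
      exact W.zero_mem
    · have : LieModule.IsIrreducible k s X := LieModule.IsIrreducible.mk hN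
      exact h (LieModuleBundle.mk X) LieModuleHom.id LieModuleHom.id
        ⟨this, inferInstance, fun _ ↦ rfl⟩

variable {X : Type u} [AddCommGroup X] [Module k X] [LieRingModule s X] [LieModule k s X]
  [FiniteDimensional k X]

theorem exists_irreducibleSummand_proj_ne_zero {x : X} (hx : x ≠ 0) :
    ∃ (B : LieModuleBundle k s) (i : B.carrier →ₗ⁅k,s⁆ X) (p : X →ₗ⁅k,s⁆ B.carrier),
      IsIrreducibleSummand B i p ∧ p x ≠ 0 := by
  by_contra! h
  refine hx ((Submodule.mem_bot k).mp
    (mem_of_forall_irreducibleSummand (s := s) _ X rfl ⊥ x fun B i p hB ↦ ?_))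
  rw [h B i p hB, map_zero]
  exact Submodule.zero_mem _

theorem exists_irreducibleSummand_apply_ne_zero {A : Type*} [AddCommGroup A] [Module k A]
    (g : X →ₗ[k] A) (hg : g ≠ 0) :
    ∃ (B : LieModuleBundle k s) (i : B.carrier →ₗ⁅k,s⁆ X) (p : X →ₗ⁅k,s⁆ B.carrier),
      IsIrreducibleSummand B i p ∧ ∃ t, g (i t) ≠ 0 := by
  by_contra! h
  refine hg (LinearMap.ext fun x ↦ ?_)
  exact mem_of_forall_irreducibleSummand (s := s) _ X rfl (LinearMap.ker g) x fun B i p hB ↦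
    h B i p hB (p x)

end CompleteReducibility

section Weights

open LieModule

variable {k s} {H}
variable {M : Type u} [AddCommGroup M] [Module k M] [LieRingModule s M] [LieModule k s M]
variable {N : Type u} [AddCommGroup N] [Module k N] [LieRingModule s N] [LieModule k s N]

theorem iSup_wtSpace_adjoint : ⨆ χ, wtSpace k s H s χ = ⊤ := by
  have h := iSup_genWeightSpace_eq_top' k H s
  rw [← LieSubmodule.toSubmodule_inj, LieSubmodule.iSup_toSubmodule,
    LieSubmodule.top_toSubmodule] at h
  rw [eq_top_iff, ← h]
  refine iSup_le fun χ ↦ le_iSup_of_le (Weight.toLinear k H s χ) fun x hx y ↦ ?_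
  exact LieAlgebra.IsKilling.lie_eq_smul_of_mem_rootSpace hx y

theorem mem_cartan_of_mem_wtSpace_zero {x : s} (hx : x ∈ wtSpace k s H s 0) : x ∈ H := by
  rw [← LieSubalgebra.IsCartanSubalgebra.self_normalizing (H := H),
    LieSubalgebra.mem_normalizer_iff']
  intro y hy
  have := hx ⟨y, hy⟩
  rw [this]
  simp

theorem lie_mem_wtSpace {χ ψ : Module.Dual k H} {x : s} {m : M} (hx : x ∈ wtSpace k s H s χ)
    (hm : m ∈ wtSpace k s H M ψ) : ⁅x, m⁆ ∈ wtSpace k s H M (χ + ψ) := fun y ↦ by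
  rw [leibniz_lie, hx y, hm y, smul_lie, lie_smul, LinearMap.add_apply, add_smul]

theorem LieModuleHom.apply_mem_wtSpace (f : M →ₗ⁅k,s⁆ N) {ψ : Module.Dual k H} {m : M}
    (hm : m ∈ wtSpace k s H M ψ) : f m ∈ wtSpace k s H N ψ := fun y ↦ by
  rw [← LieModuleHom.map_lie, hm y, map_smul]

theorem isWeightOf_of_mem {ψ : Module.Dual k H} {m : M} (hm : m ∈ wtSpace k s H M ψ)
    (h0 : m ≠ 0) : IsWeightOf k s H M ψ := fun h ↦ h0 <| by
  rw [h] at hm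
  exact hm

theorem IsWeightOf.exists_ne_zero {ψ : Module.Dual k H} (h : IsWeightOf k s H M ψ) :
    ∃ m ∈ wtSpace k s H M ψ, m ≠ 0 :=
  Submodule.exists_mem_ne_zero_of_ne_bot h

theorem wtSpace_le_genWeightSpace (ψ : Module.Dual k H) :
    wtSpace k s H M ψ ≤ (genWeightSpace M ψ : LieSubmodule k H M).toSubmodule := fun m hm ↦
  weightSpace_le_genWeightSpace M (L := H) (R := k) ψ <|
    (mem_weightSpace (M := M) (L := H) (R := k) ψ m).mpr hm

theorem iSupIndep_wtSpace : iSupIndep fun ψ : Module.Dual k H ↦ wtSpace k s H M ψ := by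
  have h := LieSubmodule.iSupIndep_toSubmodule.mpr (iSupIndep_genWeightSpace k H M)
  exact (h.comp (f := fun ψ : Module.Dual k H ↦ (ψ : H → k)) DFunLike.coe_injective).mono
    wtSpace_le_genWeightSpace

theorem finite_isWeightOf [FiniteDimensional k M] : {ψ | IsWeightOf k s H M ψ}.Finite :=
  WellFoundedGT.finite_ne_bot_of_iSupIndep iSupIndep_wtSpace

theorem exists_isWeightOf [FiniteDimensional k M] [Nontrivial M] :
    ∃ ψ, IsWeightOf k s H M ψ := by
  obtain ⟨χ, hχ⟩ := exists_nontrivial_weightSpace_of_isSolvable k H M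
  obtain ⟨⟨m, hm⟩, h0⟩ := exists_ne (0 : weightSpace M χ)
  exact ⟨χ, isWeightOf_of_mem (fun y ↦ (mem_weightSpace (M := M) (L := H) (R := k) χ m).mp hm y)
    (fun h ↦ h0 (Subtype.ext h))⟩

theorem eq_zero_or_isRoot_of_mem {χ : Module.Dual k H} {x : s} (hx : x ∈ wtSpace k s H s χ) :
    x = 0 ∨ χ = 0 ∨ IsRoot k s H χ := by
  by_cases h : x = 0
  · exact Or.inl h
  · by_cases h' : χ = 0
    · exact Or.inr (Or.inl h')
    · exact Or.inr (Or.inr ⟨h', isWeightOf_of_mem hx h⟩)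

/-- A subspace stable under the Cartan subalgebra and all root vectors is a submodule. -/
theorem lie_mem_of_forall_isRoot (U : Submodule k M) (hH : ∀ y : H, ∀ m ∈ U, ⁅(y : s), m⁆ ∈ U)
    (hroot : ∀ χ, IsRoot k s H χ → ∀ x ∈ wtSpace k s H s χ, ∀ m ∈ U, ⁅x, m⁆ ∈ U)
    (x : s) {m : M} (hm : m ∈ U) : ⁅x, m⁆ ∈ U := by
  have hx : x ∈ ⨆ χ, wtSpace k s H s χ := iSup_wtSpace_adjoint (k := k) (H := H) ▸ Submodule.mem_top
  induction hx using Submodule.iSup_induction' with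
  | mem χ x hx =>
    rcases eq_zero_or_isRoot_of_mem hx with rfl | rfl | h
    · rw [zero_lie]
      exact U.zero_mem
    · exact hH ⟨x, mem_cartan_of_mem_wtSpace_zero hx⟩ m hm
    · exact hroot χ h x hx m hm
  | zero => rw [zero_lie]; exact U.zero_mem
  | add x y _ _ hx hy => rw [add_lie]; exact U.add_mem hx hy

theorem lie_mem_iSup_wtSpace (x : s) {m : M} (hm : m ∈ ⨆ ψ, wtSpace k s H M ψ) :
    ⁅x, m⁆ ∈ ⨆ ψ, wtSpace k s H M ψ := by
  have hx : x ∈ ⨆ χ, wtSpace k s H s χ := iSup_wtSpace_adjoint (k := k) (H := H) ▸ Submodule.mem_top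
  induction hx using Submodule.iSup_induction' with
  | mem χ x hx =>
    induction hm using Submodule.iSup_induction' with
    | mem ψ m hm => exact Submodule.mem_iSup_of_mem _ (lie_mem_wtSpace hx hm)
    | zero => rw [lie_zero]; exact Submodule.zero_mem _
    | add m n _ _ hm hn => rw [lie_add]; exact Submodule.add_mem _ hm hn
  | zero => rw [zero_lie]; exact Submodule.zero_mem _
  | add x y _ _ hx hy => rw [add_lie]; exact Submodule.add_mem _ hx hy

theorem iSup_wtSpace_eq_top [FiniteDimensional k M] [IsIrreducible k s M] :
    ⨆ ψ, wtSpace k s H M ψ = ⊤ := by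
  have hM : Nontrivial M := (LieSubmodule.nontrivial_iff k s M).mp inferInstance
  let U : LieSubmodule k s M := { (⨆ ψ, wtSpace k s H M ψ : Submodule k M) with
    lie_mem := fun {x m} hm ↦ lie_mem_iSup_wtSpace x hm }
  have hU : U = ⊤ := (eq_bot_or_eq_top U).resolve_left fun h ↦ by
    obtain ⟨ψ, hψ⟩ := exists_isWeightOf (k := k) (s := s) (H := H) (M := M)
    obtain ⟨m, hm, h0⟩ := hψ.exists_ne_zero
    have : m ∈ U := Submodule.mem_iSup_of_mem (p := fun ψ ↦ wtSpace k s H M ψ) ψ hm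
    rw [h] at this
    exact h0 this
  exact (congrArg LieSubmodule.toSubmodule hU :)

end Weights

section PositiveSystem

variable {k s} {H}
variable {Pos : Set (Module.Dual k H)}

theorem IsRoot.exists_root {χ : Module.Dual k H} (h : IsRoot k s H χ) :
    ∃ α : H.root, LieModule.Weight.toLinear k H s α = χ := by
  obtain ⟨x, hx, h0⟩ := h.2.exists_ne_zero
  have hx' := wtSpace_le_genWeightSpace χ hx
  refine ⟨⟨⟨χ, fun hb ↦ h0 ?_⟩, ?_⟩, ?_⟩
  · rw [hb] at hx'
    exact hx'
  · simp only [LieSubalgebra.root, Finset.mem_filter, Finset.mem_univ, true_and]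
    intro hz
    exact h.1 (DFunLike.coe_injective hz)
  · rfl

theorem isRoot_toLinear (α : H.root) : IsRoot k s H (LieModule.Weight.toLinear k H s α) := by
  constructor
  · rw [LieModule.Weight.coe_toLinear_ne_zero_iff]
    exact LieSubalgebra.isNonZero_coe_root α
  · obtain ⟨x, hx, h0⟩ := (α : LieModule.Weight k H s).exists_ne_zero
    exact isWeightOf_of_mem
      (fun y ↦ LieAlgebra.IsKilling.lie_eq_smul_of_mem_rootSpace hx y) h0

theorem IsPositiveSystem.sum_ne_zero (hPos : IsPositiveSystem k s H Pos) (n : ℕ)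
    (f : Fin (n + 1) → Module.Dual k H) (hf : ∀ i, f i ∈ Pos) : ∑ i, f i ≠ 0 := by
  induction n with
  | zero => simpa using (hPos.1 _ (hf 0)).1
  | succ n ih =>
    intro h
    obtain ⟨α, hα⟩ := (hPos.1 _ (hf 0)).exists_root
    choose β hβ using fun i : Fin (n + 1) ↦ (hPos.1 _ (hf i.succ)).exists_root
    set P := LieAlgebra.IsKilling.rootSystem H
    have hpair (i : Fin (n + 1)) : f i.succ (LieAlgebra.IsKilling.coroot α.1) =
        (P.pairingIn ℤ (β i) α : k) := by
      have := P.algebraMap_pairingIn ℤ (β i) α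
      rw [LieAlgebra.IsKilling.rootSystem_pairing_apply] at this
      rw [← hβ]
      exact this.symm
    rw [Fin.sum_univ_succ] at h
    have h2 : (2 : ℤ) + ∑ i, P.pairingIn ℤ (β i) α = 0 := by
      have h1 := LinearMap.congr_fun h (LieAlgebra.IsKilling.coroot α.1)
      rw [LinearMap.add_apply, LinearMap.sum_apply, Finset.sum_congr rfl fun i _ ↦ hpair i, ← hα,
        LieModule.Weight.toLinear_apply, LieAlgebra.IsKilling.root_apply_coroot
          (LieSubalgebra.isNonZero_coe_root α), LinearMap.zero_apply] at h1
      exact_mod_cast h1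
    obtain ⟨i, hi⟩ : ∃ i, P.pairingIn ℤ (β i) α < 0 := by
      by_contra! hc
      have := Finset.sum_nonneg fun i (_ : i ∈ Finset.univ) ↦ hc i
      omega
    have hne : P.root (β i) ≠ -P.root α := by
      rw [LieAlgebra.IsKilling.rootSystem_root_apply, LieAlgebra.IsKilling.rootSystem_root_apply,
        hα, hβ]
      intro he
      exact (hPos.2.1 _ (hPos.1 _ (hf 0))).mp (hf 0) (he ▸ hf _)
    obtain ⟨γ, hγ⟩ := P.root_add_root_mem_of_pairingIn_neg hi hne
    rw [LieAlgebra.IsKilling.rootSystem_root_apply, LieAlgebra.IsKilling.rootSystem_root_apply,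
        LieAlgebra.IsKilling.rootSystem_root_apply, hα, hβ] at hγ
    have hmem := hPos.2.2 _ (hf i.succ) _ (hf 0) (hγ ▸ isRoot_toLinear γ)
    refine ih (Function.update (fun j ↦ f j.succ) i (f i.succ + f 0)) (fun j ↦ ?_) ?_
    · rcases eq_or_ne j i with rfl | hj
      · simpa using hmem
      · simpa [hj] using hf _
    · rw [← h, Finset.sum_update_of_mem (Finset.mem_univ i),
        ← Finset.add_sum_erase Finset.univ (fun j : Fin (n + 1) ↦ f j.succ) (Finset.mem_univ i),
        Finset.sdiff_singleton_eq_erase]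
      abel

theorem IsPositiveSystem.add_ne_zero (hPos : IsPositiveSystem k s H Pos) {α δ : Module.Dual k H}
    (hα : α ∈ Pos) (hδ : δ ∈ AddSubmonoid.closure Pos) : α + δ ≠ 0 := by
  obtain ⟨l, hl, rfl⟩ := AddSubmonoid.exists_list_of_mem_closure hδ
  have hl' : ∀ y ∈ α :: l, y ∈ Pos := by simpa using ⟨hα, hl⟩
  have := hPos.sum_ne_zero l.length (fun i ↦ (α :: l)[i]) fun i ↦
    hl' _ (List.getElem_mem (l := α :: l) i.2)
  rw [← List.sum_cons]
  convert this
  exact (Fin.sum_univ_getElem (α :: l)).symm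

theorem IsPositiveSystem.eq_zero_of_add_eq_zero (hPos : IsPositiveSystem k s H Pos)
    {δ ε : Module.Dual k H} (hδ : δ ∈ AddSubmonoid.closure Pos)
    (hε : ε ∈ AddSubmonoid.closure Pos) (h : δ + ε = 0) : δ = 0 := by
  induction hδ using AddSubmonoid.closure_induction_left with
  | zero => rfl
  | add_left α hα δ hδ _ =>
    rw [add_assoc] at h
    exact absurd h (hPos.add_ne_zero hα (add_mem hδ hε))

end PositiveSystem

section HighestWeight

open LieModule

variable {k s} {H} {Pos : Set (Module.Dual k H)}
variable {M : Type u} [AddCommGroup M] [Module k M] [LieRingModule s M] [LieModule k s M]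
variable {N : Type u} [AddCommGroup N] [Module k N] [LieRingModule s N] [LieModule k s N]

theorem IsPositiveSystem.mem_or_neg_mem (hPos : IsPositiveSystem k s H Pos) {χ : Module.Dual k H}
    (h : IsRoot k s H χ) : χ ∈ Pos ∨ -χ ∈ Pos := by
  by_contra! hc
  exact hc.1 ((hPos.2.1 χ h).mpr hc.2)

theorem IsHighestWeightOf.unique (hPos : IsPositiveSystem k s H Pos) {lam mu : Module.Dual k H}
    (h : IsHighestWeightOf k s H Pos M lam) (h' : IsHighestWeightOf k s H Pos M mu) :
    lam = mu :=
  sub_eq_zero.mp <| hPos.eq_zero_of_add_eq_zero (h.2 _ h'.1) (h'.2 _ h.1) (by abel)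

variable (k s H Pos) in
/-- A vector killed by all positive root vectors. -/
def IsSingular (m : M) : Prop :=
  ∀ β ∈ Pos, ∀ x ∈ wtSpace k s H s β, ⁅x, m⁆ = 0

theorem IsHighestWeightOf.isSingular (hPos : IsPositiveSystem k s H Pos) {lam : Module.Dual k H}
    (h : IsHighestWeightOf k s H Pos M lam) {m : M} (hm : m ∈ wtSpace k s H M lam) :
    IsSingular k s H Pos m := fun β hβ x hx ↦ by
  by_contra h0
  have := h.2 _ (isWeightOf_of_mem (lie_mem_wtSpace hx hm) h0)
  exact hPos.add_ne_zero hβ this (by abel)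

theorem IsSingular.map {m : M} (hm : IsSingular k s H Pos m) (f : M →ₗ⁅k,s⁆ N) :
    IsSingular k s H Pos (f m) := fun β hβ x hx ↦ by
  rw [← LieModuleHom.map_lie, hm β hβ x hx, map_zero]

theorem iSup_wtSpace_sub_closure_eq_top_of_isSingular [IsIrreducible k s M]
    (hPos : IsPositiveSystem k s H Pos)
    {lam : Module.Dual k H} {v : M} (hv : v ∈ wtSpace k s H M lam) (h0 : v ≠ 0)
    (hsing : IsSingular k s H Pos v) :
    ⨆ δ ∈ AddSubmonoid.closure Pos, wtSpace k s H M (lam - δ) = ⊤ := by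
  let S : Set (Submodule k M) := {W | v ∈ W ∧ ∀ β ∈ Pos, ∀ x ∈ wtSpace k s H s (-β),
    ∀ m ∈ W, ⁅x, m⁆ ∈ W}
  let U : Submodule k M := sInf S
  have hvU : v ∈ U := by
    rw [Submodule.mem_sInf]
    exact fun W hW ↦ hW.1
  have hnegU : ∀ β ∈ Pos, ∀ x ∈ wtSpace k s H s (-β), ∀ m ∈ U, ⁅x, m⁆ ∈ U := by
    intro β hβ x hx m hm
    rw [Submodule.mem_sInf] at hm ⊢
    exact fun W hW ↦ hW.2 β hβ x hx m (hm W hW)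
  have hle (W : Submodule k M) (hW : W ∈ S) : U ≤ W := sInf_le hW
  have hHU (y : H) (m : M) (hm : m ∈ U) : ⁅(y : s), m⁆ ∈ U := by
    let W : Submodule k M := U ⊓ U.comap (toEnd k s M (y : s))
    refine (hle W ⟨⟨hvU, ?_⟩, ?_⟩ hm).2
    · show ⁅(y : s), v⁆ ∈ U
      rw [hv y]
      exact U.smul_mem _ hvU
    · intro β hβ x hx m hm
      refine ⟨hnegU β hβ x hx m hm.1, ?_⟩
      show ⁅(y : s), ⁅x, m⁆⁆ ∈ U
      rw [leibniz_lie, hx y, smul_lie]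
      exact U.add_mem (U.smul_mem _ (hnegU β hβ x hx m hm.1)) (hnegU β hβ x hx _ hm.2)
  have hposU : ∀ β ∈ Pos, ∀ x ∈ wtSpace k s H s β, ∀ m ∈ U, ⁅x, m⁆ ∈ U := by
    let W : Submodule k M := U ⊓ ⨅ β : Pos, ⨅ x : wtSpace k s H s (β : Module.Dual k H),
      U.comap (toEnd k s M (x : s))
    have hW (m : M) : m ∈ W ↔ m ∈ U ∧ ∀ β ∈ Pos, ∀ x ∈ wtSpace k s H s β, ⁅x, m⁆ ∈ U := by
      simp [W]
    intro β hβ x hx m hm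
    refine ((hW m).mp (hle W ⟨(hW v).mpr ⟨hvU, ?_⟩, ?_⟩ hm)).2 β hβ x hx
    · intro β hβ x hx
      rw [hsing β hβ x hx]
      exact U.zero_mem
    · intro γ hγ y hy m hm
      obtain ⟨hm, hpos⟩ := (hW m).mp hm
      refine (hW _).mpr ⟨hnegU γ hγ y hy m hm, fun β hβ x hx ↦ ?_⟩
      rw [leibniz_lie]
      refine U.add_mem ?_ (hnegU γ hγ y hy _ (hpos β hβ x hx))
      have hxy := lie_mem_wtSpace hx hy
      rcases eq_zero_or_isRoot_of_mem hxy with h | h | h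
      · rw [h, zero_lie]
        exact U.zero_mem
      · rw [h] at hxy
        exact hHU ⟨_, mem_cartan_of_mem_wtSpace_zero hxy⟩ m hm
      · rcases hPos.mem_or_neg_mem h with h | h
        · exact hpos _ h _ hxy
        · exact hnegU _ h _ (by rwa [neg_neg]) m hm
  let L : LieSubmodule k s M := { U with
    lie_mem := fun {x m} hm ↦ lie_mem_of_forall_isRoot (H := H) U hHU (fun χ hχ x hx m hm ↦ by
      rcases hPos.mem_or_neg_mem hχ with h | h
      · exact hposU χ h x hx m hm
      · exact hnegU _ h x (by rwa [neg_neg]) m hm) x hm }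
  have hL : L = ⊤ := (eq_bot_or_eq_top L).resolve_left fun hL ↦ h0 <| by
    have : v ∈ L := hvU
    simpa [hL] using this
  have hU : U = ⊤ := congrArg LieSubmodule.toSubmodule hL
  rw [eq_top_iff, ← hU]
  refine hle _ ⟨?_, ?_⟩
  · refine Submodule.mem_iSup_of_mem 0 (Submodule.mem_iSup_of_mem (zero_mem _) ?_)
    rwa [sub_zero]
  · intro β hβ x hx m hm
    suffices h : (⨆ δ ∈ AddSubmonoid.closure Pos, wtSpace k s H M (lam - δ)) ≤
        (⨆ δ ∈ AddSubmonoid.closure Pos, wtSpace k s H M (lam - δ)).comap (toEnd k s M x) from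
      h hm
    refine iSup₂_le fun δ hδ m hm ↦ ?_
    have := lie_mem_wtSpace hx hm
    rw [show -β + (lam - δ) = lam - (β + δ) by abel] at this
    exact Submodule.mem_iSup_of_mem (β + δ) (Submodule.mem_iSup_of_mem
      (add_mem (AddSubmonoid.subset_closure hβ) hδ) this)

theorem isHighestWeightOf_of_isSingular [IsIrreducible k s M] (hPos : IsPositiveSystem k s H Pos)
    {lam : Module.Dual k H} {v : M} (hv : v ∈ wtSpace k s H M lam) (h0 : v ≠ 0)
    (hsing : IsSingular k s H Pos v) : IsHighestWeightOf k s H Pos M lam := by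
  refine ⟨isWeightOf_of_mem hv h0, fun χ hχ ↦ ?_⟩
  by_contra hn
  have htop := iSup_wtSpace_sub_closure_eq_top_of_isSingular hPos hv h0 hsing
  have hle : ⨆ δ ∈ AddSubmonoid.closure Pos, wtSpace k s H M (lam - δ) ≤
      ⨆ ψ, ⨆ _ : ψ ≠ χ, wtSpace k s H M ψ :=
    iSup₂_le fun δ hδ ↦ le_iSup₂_of_le (lam - δ) (by
      rintro rfl
      exact hn (by simpa using hδ)) le_rfl
  rw [htop, top_le_iff] at hle
  have hdisj := (iSupIndep_wtSpace (k := k) (H := H) (M := M)) χ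
  rw [hle, disjoint_top] at hdisj
  exact hχ hdisj

theorem exists_isHighestWeightOf [FiniteDimensional k M] [IsIrreducible k s M]
    (hPos : IsPositiveSystem k s H Pos) : ∃ lam, IsHighestWeightOf k s H Pos M lam := by
  have hM : Nontrivial M := (LieSubmodule.nontrivial_iff k s M).mp inferInstance
  obtain ⟨ψ, hψ⟩ := exists_isWeightOf (k := k) (s := s) (H := H) (M := M)
  have hfin : Finite {ψ | IsWeightOf k s H M ψ} := finite_isWeightOf
  let r : {ψ | IsWeightOf k s H M ψ} → {ψ | IsWeightOf k s H M ψ} → Prop :=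
    fun χ ψ ↦ ∃ β ∈ Pos, ∃ δ ∈ AddSubmonoid.closure Pos, (χ : Module.Dual k H) = ψ + (β + δ)
  have : IsTrans _ r := ⟨by
    rintro χ₁ χ₂ χ₃ ⟨β, hβ, δ, hδ, h⟩ ⟨β', hβ', δ', hδ', h'⟩
    refine ⟨β, hβ, δ + (β' + δ'),
      add_mem hδ (add_mem (AddSubmonoid.subset_closure hβ') hδ'), ?_⟩
    rw [h, h']
    abel⟩
  have : Std.Irrefl r := ⟨by
    rintro χ ⟨β, hβ, δ, hδ, h⟩
    exact hPos.add_ne_zero hβ hδ (by simpa using h)⟩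
  obtain ⟨lam, -, hlam⟩ :=
    (Finite.wellFounded_of_trans_of_irrefl r).has_min Set.univ ⟨⟨ψ, hψ⟩, trivial⟩
  obtain ⟨v, hv, h0⟩ := IsWeightOf.exists_ne_zero lam.2
  refine ⟨lam, isHighestWeightOf_of_isSingular hPos hv h0 fun β hβ x hx ↦ ?_⟩
  by_contra hne
  refine hlam ⟨_, isWeightOf_of_mem (lie_mem_wtSpace hx hv) hne⟩ trivial
    ⟨β, hβ, 0, zero_mem _, ?_⟩
  simp [add_comm]

theorem LieModuleHom.injective_of_isIrreducible [IsIrreducible k s M] (f : M →ₗ⁅k,s⁆ N)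
    (hf : f ≠ 0) : Function.Injective f := by
  have : f.ker = ⊥ := (eq_bot_or_eq_top f.ker).resolve_right fun h ↦ hf <| by
    ext m
    exact (LieModuleHom.mem_ker (f := f)).mp (h ▸ LieSubmodule.mem_top m)
  exact (LieModuleHom.ker_eq_bot f).mp this

theorem IsHighestWeightOf.of_hom [IsIrreducible k s M] [IsIrreducible k s N]
    (hPos : IsPositiveSystem k s H Pos) {lam : Module.Dual k H}
    (h : IsHighestWeightOf k s H Pos M lam) (f : M →ₗ⁅k,s⁆ N) (hf : f ≠ 0) :
    IsHighestWeightOf k s H Pos N lam := by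
  obtain ⟨v, hv, h0⟩ := h.1.exists_ne_zero
  exact isHighestWeightOf_of_isSingular hPos (f.apply_mem_wtSpace hv)
    (fun h ↦ h0 (f.injective_of_isIrreducible hf (by rw [h, map_zero])))
    ((h.isSingular hPos hv).map f)

end HighestWeight

section Linkage

open LieModule

variable {k s} {H} {Pos : Set (Module.Dual k H)}
variable {V : Type u} [AddCommGroup V] [Module k V] [LieRingModule s V] [LieModule k s V]

theorem IsPositiveSystem.closure_le (hPos : IsPositiveSystem k s H Pos) {δ : Module.Dual k H}
    (hδ : δ ∈ AddSubmonoid.closure Pos) : δ ∈ rootLattice k s H := by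
  have : AddSubmonoid.closure Pos ≤ (rootLattice k s H).toAddSubmonoid := by
    rw [AddSubmonoid.closure_le]
    exact fun β hβ ↦ AddSubgroup.subset_closure (hPos.1 β hβ)
  exact this hδ

theorem hwStep.sub_sub_mem [FiniteDimensional k V] [IsIrreducible k s V]
    (hPos : IsPositiveSystem k s H Pos)
    {ν : Module.Dual k H} (hν : IsHighestWeightOf k s H Pos V ν) {p q : Module.Dual k H × k}
    (h : hwStep k s H Pos V p q) : q.1 - p.1 - ν ∈ rootLattice k s H := by
  obtain ⟨-, B, C, hB, hBf, hC, hCf, hp, hq, f, hf⟩ := h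
  obtain ⟨χ, v, hv, ψ, m, hm, h0⟩ : ∃ χ, ∃ v ∈ wtSpace k s H V χ,
      ∃ ψ, ∃ m ∈ wtSpace k s H B.carrier ψ, f (v ⊗ₜ m) ≠ 0 := by
    by_contra! hc
    refine hf ?_
    have hz (v : V) (m : B.carrier) : f (v ⊗ₜ m) = 0 := by
      have hv : v ∈ ⨆ χ, wtSpace k s H V χ := by
        rw [iSup_wtSpace_eq_top]
        exact Submodule.mem_top
      have hm : m ∈ ⨆ χ, wtSpace k s H B.carrier χ := by
        rw [iSup_wtSpace_eq_top]
        exact Submodule.mem_top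
      induction hv using Submodule.iSup_induction' with
      | mem χ v hv =>
        induction hm using Submodule.iSup_induction' with
        | mem ψ m hm => exact hc χ v hv ψ m hm
        | zero => rw [TensorProduct.tmul_zero, map_zero]
        | add m n _ _ hm hn => rw [TensorProduct.tmul_add, map_add, hm, hn, add_zero]
      | zero => rw [TensorProduct.zero_tmul, map_zero]
      | add v w _ _ hv hw => rw [TensorProduct.add_tmul, map_add, hv, hw, add_zero]
    ext t
    induction t with
    | zero => rw [map_zero, map_zero]
    | tmul v m => exact hz v m
    | add t u ht hu => rw [map_add, map_add, ht, hu]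
  have hmem : v ⊗ₜ m ∈ wtSpace k s H (V ⊗[k] B.carrier) (χ + ψ) := fun y ↦ by
    rw [TensorProduct.LieModule.lie_tmul_right, hv y, hm y, LinearMap.add_apply, add_smul,
      TensorProduct.smul_tmul', TensorProduct.tmul_smul]
  have h1 := hPos.closure_le (hν.2 χ (isWeightOf_of_mem hv (by
    rintro rfl
    rw [TensorProduct.zero_tmul, map_zero] at h0
    exact h0 rfl)))
  have h2 := hPos.closure_le (hp.2 ψ (isWeightOf_of_mem hm (by
    rintro rfl
    rw [TensorProduct.tmul_zero, map_zero] at h0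
    exact h0 rfl)))
  have h3 := hPos.closure_le (hq.2 _ (isWeightOf_of_mem (f.apply_mem_wtSpace hmem) h0))
  have := sub_mem (sub_mem h3 h2) h1
  convert this using 1
  abel

theorem exists_int_of_eqvGen [FiniteDimensional k V] [IsIrreducible k s V]
    (hPos : IsPositiveSystem k s H Pos)
    {ν : Module.Dual k H} (hν : IsHighestWeightOf k s H Pos V ν) {p q : Module.Dual k H × k}
    (h : Relation.EqvGen (hwStep k s H Pos V) p q) :
    ∃ n : ℤ, q.1 - p.1 - n • ν ∈ rootLattice k s H ∧ q.2 = p.2 + (n : k) := by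
  induction h with
  | rel p q h => exact ⟨1, by simpa using h.sub_sub_mem hPos hν, by simpa using h.1⟩
  | refl p => exact ⟨0, by simp⟩
  | symm p q _ ih =>
    obtain ⟨n, hn, hn'⟩ := ih
    refine ⟨-n, ?_, by rw [hn']; push_cast; ring⟩
    convert neg_mem hn using 1
    rw [neg_smul]
    abel
  | trans p q r _ _ ih ih' =>
    obtain ⟨n, hn, hn'⟩ := ih
    obtain ⟨m, hm, hm'⟩ := ih'
    refine ⟨n + m, ?_, by rw [hm', hn']; push_cast; ring⟩
    convert add_mem hn hm using 1
    rw [add_smul]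
    abel

variable (H Pos V) in
/-- The highest weight of every irreducible summand of `X`, taken at level `c`, is linked
to `p`. -/
def IsLinked (p : Module.Dual k H × k) (X : Type u) [AddCommGroup X] [Module k X]
    [LieRingModule s X] [LieModule k s X] (c : k) : Prop :=
  ∀ (B : LieModuleBundle k s) (i : B.carrier →ₗ⁅k,s⁆ X) (q : X →ₗ⁅k,s⁆ B.carrier),
    IsIrreducibleSummand B i q → ∀ κ, IsHighestWeightOf k s H Pos B.carrier κ →
      Relation.EqvGen (hwStep k s H Pos V) p (κ, c)

variable {X : Type u} [AddCommGroup X] [Module k X] [LieRingModule s X] [LieModule k s X]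
variable {Y : Type u} [AddCommGroup Y] [Module k Y] [LieRingModule s Y] [LieModule k s Y]

theorem IsIrreducibleSummand.nontrivial {B : LieModuleBundle k s} {i : B.carrier →ₗ⁅k,s⁆ X}
    {q : X →ₗ⁅k,s⁆ B.carrier} (h : IsIrreducibleSummand B i q) : Nontrivial B.carrier :=
  have := h.irreducible
  (LieSubmodule.nontrivial_iff k s B.carrier).mp inferInstance

theorem IsIrreducibleSummand.exists_apply_ne_zero {B : LieModuleBundle k s}
    {i : B.carrier →ₗ⁅k,s⁆ X}
    {q : X →ₗ⁅k,s⁆ B.carrier} (h : IsIrreducibleSummand B i q) : ∃ t, i t ≠ 0 := by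
  have := h.nontrivial
  obtain ⟨t, ht⟩ := exists_ne (0 : B.carrier)
  exact ⟨t, fun h0 ↦ ht (by rw [← h.leftInverse t, h0, map_zero])⟩

theorem isLinked_self [IsIrreducible k s X]
    (hPos : IsPositiveSystem k s H Pos) {lam : Module.Dual k H}
    (h : IsHighestWeightOf k s H Pos X lam) (a : k) : IsLinked H Pos V (lam, a) X a := by
  intro B i q hB κ hκ
  have := hB.irreducible
  obtain ⟨t, ht⟩ := hB.exists_apply_ne_zero
  have := hκ.of_hom hPos i (fun h0 ↦ ht (by rw [h0, LieModuleHom.zero_apply]))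
  rw [h.unique hPos this]
  exact Relation.EqvGen.refl _

theorem IsLinked.tensor [FiniteDimensional k V] [FiniteDimensional k X]
    (hPos : IsPositiveSystem k s H Pos)
    {p : Module.Dual k H × k} {c : k} (h : IsLinked H Pos V p X c) :
    IsLinked H Pos V p (V ⊗[k] X) (c + 1) := by
  intro B i q hB κ hκ
  let g : X →ₗ[k] V →ₗ[k] B.carrier := (TensorProduct.curry (q : V ⊗[k] X →ₗ[k] B.carrier)).flip
  have hg : g ≠ 0 := fun h0 ↦ by
    have hq : (q : V ⊗[k] X →ₗ[k] B.carrier) = 0 := TensorProduct.ext' fun v x ↦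
      LinearMap.congr_fun (LinearMap.congr_fun h0 x) v
    have := hB.nontrivial
    obtain ⟨t, ht⟩ := exists_ne (0 : B.carrier)
    exact ht ((hB.leftInverse t).symm.trans (LinearMap.congr_fun hq (i t)))
  obtain ⟨C, j, r, hC, t, ht⟩ := exists_irreducibleSummand_apply_ne_zero (s := s) g hg
  have := hC.irreducible
  have := hC.finiteDimensional
  obtain ⟨κ', hκ'⟩ := exists_isHighestWeightOf (M := C.carrier) hPos
  refine (h C j r hC κ' hκ').trans _ _ _ (Relation.EqvGen.rel _ _ ⟨rfl, C, B, hC.irreducible,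
    hC.finiteDimensional, hB.irreducible, hB.finiteDimensional, hκ', hκ,
    q.comp (TensorProduct.LieModule.map LieModuleHom.id j), fun h0 ↦ ht ?_⟩)
  ext v
  exact LieModuleHom.congr_fun h0 (v ⊗ₜ t)

/-- The morphism `V ⊗ Y → X` obtained from `Y → Hom(V, X)` by evaluation. -/
noncomputable def uncurryHom (i : Y →ₗ⁅k,s⁆ (V →ₗ[k] X)) : V ⊗[k] Y →ₗ⁅k,s⁆ X :=
  { TensorProduct.lift (i : Y →ₗ[k] V →ₗ[k] X).flip with
    map_lie' := fun {x t} ↦ by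
      induction t with
      | zero => simp
      | tmul v y =>
        simp [TensorProduct.LieModule.lie_tmul_right]
      | add t u ht hu =>
        simp only [AddHom.toFun_eq_coe, LinearMap.coe_toAddHom, lie_add, map_add] at ht hu ⊢
        rw [ht, hu] }

theorem IsLinked.hom [FiniteDimensional k V] [FiniteDimensional k X]
    (hPos : IsPositiveSystem k s H Pos)
    {p : Module.Dual k H × k} {c : k} (h : IsLinked H Pos V p X (c + 1)) :
    IsLinked H Pos V p (V →ₗ[k] X) c := by
  intro B i q hB κ hκ
  obtain ⟨t, ht⟩ := hB.exists_apply_ne_zero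
  obtain ⟨v, hv⟩ : ∃ v, i t v ≠ 0 := by
    by_contra! h0
    exact ht (LinearMap.ext h0)
  obtain ⟨C, j, r, hC, hr⟩ := exists_irreducibleSummand_proj_ne_zero (k := k) (s := s) hv
  have := hC.irreducible
  have := hC.finiteDimensional
  obtain ⟨κ', hκ'⟩ := exists_isHighestWeightOf (M := C.carrier) hPos
  refine (h C j r hC κ' hκ').trans _ _ _ (Relation.EqvGen.symm _ _ (Relation.EqvGen.rel _ _
    ⟨rfl, B, C, hB.irreducible,
    hB.finiteDimensional, hC.irreducible, hC.finiteDimensional, hκ, hκ',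
    r.comp (uncurryHom i), fun h0 ↦ hr ?_⟩))
  exact LieModuleHom.congr_fun h0 (v ⊗ₜ t)

theorem IsLinked.of_injective [FiniteDimensional k Y]
    {p : Module.Dual k H × k} {c : k} (h : IsLinked H Pos V p Y c) (j : X →ₗ⁅k,s⁆ Y)
    (hj : Function.Injective j) : IsLinked H Pos V p X c := by
  intro B i q hB κ hκ
  have hinj : Function.Injective (j.comp i) :=
    hj.comp (Function.LeftInverse.injective hB.leftInverse)
  obtain ⟨r, hr⟩ := LieModuleHom.exists_leftInverse _ hinj
  exact h B _ r ⟨hB.irreducible, hB.finiteDimensional, hr⟩ κ hκ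

variable (s V X) in
/-- The morphism `s ⊗ X → Hom(V, V ⊗ X)` sending `y ⊗ x` to `v ↦ ⁅y, v⁆ ⊗ x`. -/
noncomputable def adjointTensorHom : s ⊗[k] X →ₗ⁅k,s⁆ (V →ₗ[k] V ⊗[k] X) :=
  { TensorProduct.rTensorHomToHomRTensor (.id k) V V X ∘ₗ
      (LieModule.toEnd k s V : s →ₗ[k] V →ₗ[k] V).rTensor X with
    map_lie' := fun {x t} ↦ by
      induction t with
      | zero => simp
      | tmul y w =>
        ext v
        simp [TensorProduct.LieModule.lie_tmul_right, TensorProduct.sub_tmul]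
        abel
      | add t u ht hu =>
        simp only [AddHom.toFun_eq_coe, LinearMap.coe_toAddHom, lie_add, map_add] at ht hu ⊢
        rw [ht, hu] }

theorem adjointTensorHom_injective [FiniteDimensional k V]
    (hV : ∀ x : s, (∀ v : V, ⁅x, v⁆ = 0) → x = 0) :
    Function.Injective (adjointTensorHom (k := k) s V X) := by
  have h1 : Function.Injective (LieModule.toEnd k s V : s →ₗ[k] V →ₗ[k] V) := by
    rw [injective_iff_map_eq_zero]
    exact fun x hx ↦ hV x fun v ↦ LinearMap.congr_fun hx v
  have h2 := Module.Flat.rTensor_preserves_injective_linearMap (M := X) _ h1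
  have h3 : Function.Injective (TensorProduct.rTensorHomToHomRTensor (.id k) V V X) := by
    rw [← rTensorHomEquivHomRTensor_toLinearMap]
    exact (rTensorHomEquivHomRTensor k V V X).injective
  exact h3.comp h2

theorem IsLinked.adjoint_tensor [FiniteDimensional k V] [FiniteDimensional k X]
    (hPos : IsPositiveSystem k s H Pos) (hV : ∀ x : s, (∀ v : V, ⁅x, v⁆ = 0) → x = 0)
    {p : Module.Dual k H × k} {c : k} (h : IsLinked H Pos V p X c) :
    IsLinked H Pos V p (s ⊗[k] X) c :=
  ((h.tensor hPos).hom hPos).of_injective _ (adjointTensorHom_injective hV)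

end Linkage

section Alternating

open LieModule

variable {k s} {H} {Pos : Set (Module.Dual k H)}
variable {V : Type u} [AddCommGroup V] [Module k V] [LieRingModule s V] [LieModule k s V]

theorem exists_smul_eq_of_mem_wtSpace {χ : Module.Dual k H} (hχ : IsRoot k s H χ) {x y : s}
    (hx : x ∈ wtSpace k s H s χ) (h0 : x ≠ 0) (hy : y ∈ wtSpace k s H s χ) :
    ∃ t : k, y = t • x := by
  obtain ⟨α, hα⟩ := hχ.exists_root
  have h1 : Module.finrank k (LieAlgebra.rootSpace H α.1) = 1 :=
    LieAlgebra.IsKilling.finrank_rootSpace_eq_one α.1 (LieSubalgebra.isNonZero_coe_root α)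
  rw [← hα] at hx hy
  have hxα : x ∈ LieAlgebra.rootSpace H α.1 :=
    weightSpace_le_genWeightSpace s (α.1 : H → k)
      ((mem_weightSpace (M := s) (L := H) (R := k) _ _).mpr hx)
  have hyα : y ∈ LieAlgebra.rootSpace H α.1 :=
    weightSpace_le_genWeightSpace s (α.1 : H → k)
      ((mem_weightSpace (M := s) (L := H) (R := k) _ _).mpr hy)
  have key (W : Submodule k s) (h1 : Module.finrank k W = 1) (hx : x ∈ W) (hy : y ∈ W) :
      ∃ t : k, y = t • x := by
    obtain ⟨t, ht⟩ := exists_smul_eq_of_finrank_eq_one h1 (x := ⟨x, hx⟩)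
      (fun h ↦ h0 (congrArg Subtype.val h)) ⟨y, hy⟩
    exact ⟨t, (congrArg Subtype.val ht).symm⟩
  exact key (LieAlgebra.rootSpace H α.1).toSubmodule h1 hxα hyα

/-- Every finite-dimensional module linked to `p` at level `c` gives a multilinear map on `s`
which is equivariant relative to the line of a given vector, and which behaves like a tensor
product of `N` copies of `s` with that line. -/
theorem IsLinked.exists_multilinearMap [FiniteDimensional k V]
    (hPos : IsPositiveSystem k s H Pos) (hV : ∀ x : s, (∀ v : V, ⁅x, v⁆ = 0) → x = 0)
    {p : Module.Dual k H × k} {c : k} {X : Type u} [AddCommGroup X] [Module k X]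
    [LieRingModule s X] [LieModule k s X] [FiniteDimensional k X] (h : IsLinked H Pos V p X c)
    {x : X} (hx : x ≠ 0) (N : ℕ) :
    ∃ Y : LieModuleBundle k s, FiniteDimensional k Y.carrier ∧
      IsLinked H Pos V p Y.carrier c ∧
      ∃ m : MultilinearMap k (fun _ : Fin N ↦ s) Y.carrier,
        (∀ (z : s) (t : k), ⁅z, x⁆ = t • x → ∀ y,
          ⁅z, m y⁆ = ∑ i, m (Function.update y i ⁅z, y i⁆) + t • m y) ∧
        ∀ φ : Fin N → Module.Dual k s, ∃ C : Module.Dual k Y.carrier,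
          ∀ y, C (m y) = ∏ i, φ i (y i) := by
  induction N with
  | zero =>
    refine ⟨LieModuleBundle.mk X, inferInstanceAs (FiniteDimensional k X), h,
      MultilinearMap.constOfIsEmpty k _ x, fun z t ht y ↦ by simpa using ht, fun φ ↦ ?_⟩
    obtain ⟨C, hC⟩ := Module.Projective.exists_dual_eq_one k hx
    exact ⟨C, fun y ↦ by simpa using hC⟩
  | succ N ih =>
    obtain ⟨Y, hYf, hY, m, hm, hC⟩ := ih
    let f : s →ₗ[k] MultilinearMap k (fun _ : Fin N ↦ s) (s ⊗[k] Y.carrier) :=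
      { toFun := fun z ↦ (TensorProduct.mk k s Y.carrier z).compMultilinearMap m
        map_add' := fun z z' ↦ by ext y; simp
        map_smul' := fun t z ↦ by ext y; simp [TensorProduct.smul_tmul'] }
    let g : MultilinearMap k (fun _ : Fin (N + 1) ↦ s) (s ⊗[k] Y.carrier) :=
      LinearMap.uncurryLeft f
    have hf (y : Fin (N + 1) → s) : g y = y 0 ⊗ₜ[k] m (Fin.tail y) := rfl
    refine ⟨LieModuleBundle.mk (s ⊗[k] Y.carrier),
      inferInstanceAs (FiniteDimensional k (s ⊗[k] Y.carrier)), hY.adjoint_tensor hPos hV,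
      g, fun z t ht y ↦ ?_, fun φ ↦ ?_⟩
    · simp only [hf, Fin.sum_univ_succ, Fin.tail_update_zero, Fin.tail_update_succ,
        Function.update_self]
      rw [TensorProduct.LieModule.lie_tmul_right, hm z t ht, TensorProduct.tmul_add,
        TensorProduct.tmul_sum, TensorProduct.tmul_smul, add_assoc]
      simp only [Fin.tail]
      congr 2
    · obtain ⟨C, hC⟩ := hC (Fin.tail φ)
      refine ⟨LinearMap.mul' k k ∘ₗ TensorProduct.map (φ 0) C, fun y ↦ ?_⟩
      rw [hf, Fin.prod_univ_succ]
      simp [hC, Fin.tail]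

theorem MultilinearMap.lie_alternatization {Y : Type u} [AddCommGroup Y] [Module k Y]
    [LieRingModule s Y] [LieModule k s Y] {N : ℕ} (m : MultilinearMap k (fun _ : Fin N ↦ s) Y)
    {z : s} {t : k} (h : ∀ y, ⁅z, m y⁆ = ∑ i, m (Function.update y i ⁅z, y i⁆) + t • m y)
    (y : Fin N → s) :
    ⁅z, MultilinearMap.alternatization m y⁆ =
      ∑ i, MultilinearMap.alternatization m (Function.update y i ⁅z, y i⁆) +
        t • MultilinearMap.alternatization m y := by
  simp only [MultilinearMap.alternatization_apply, MultilinearMap.domDomCongr_apply]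
  rw [Finset.sum_comm, Finset.smul_sum, ← Finset.sum_add_distrib, lie_sum]
  refine Finset.sum_congr rfl fun σ _ ↦ ?_
  have hl (w : Y) : ⁅z, Equiv.Perm.sign σ • w⁆ = Equiv.Perm.sign σ • ⁅z, w⁆ := by
    rcases Int.units_eq_one_or (Equiv.Perm.sign σ) with h | h <;> simp [h]
  rw [hl, h, smul_add, Finset.smul_sum, smul_comm t]
  congr 1
  refine Fintype.sum_equiv σ _ _ fun i ↦ ?_
  congr 2
  ext j
  simp [Function.update_apply]

theorem IsLinked.of_ideal [FiniteDimensional k V]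
    (hPos : IsPositiveSystem k s H Pos) (hV : ∀ x : s, (∀ v : V, ⁅x, v⁆ = 0) → x = 0)
    {N : ℕ} (β : Fin N → Module.Dual k H) (hβ : Function.Injective β) (hβPos : ∀ i, β i ∈ Pos)
    (hideal : ∀ i, ∀ γ ∈ Pos, IsRoot k s H (β i + γ) → ∃ j, β j = β i + γ)
    {lam : Module.Dual k H} (hlam : IsDominant k s H Pos lam) (a : k) :
    IsDominant k s H Pos (lam + ∑ i, β i) ∧
      Relation.EqvGen (hwStep k s H Pos V) (lam, a) (lam + ∑ i, β i, a) := by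
  obtain ⟨B, hB, hBf, hBlam⟩ := hlam
  obtain ⟨x, hx, hx0⟩ := hBlam.1.exists_ne_zero
  choose y hy hy0 using fun i ↦ (hPos.1 _ (hβPos i)).2.exists_ne_zero
  obtain ⟨Y, hYf, hY, m, hm, hC⟩ :=
    (isLinked_self (V := V) hPos hBlam a).exists_multilinearMap hPos hV hx0 N
  set A := MultilinearMap.alternatization m with hA
  have hA0 : A y ≠ 0 := fun h0 ↦ by
    have hli : LinearIndependent k y :=
      (iSupIndep_wtSpace (k := k) (s := s) (H := H) (M := s)).comp hβ |>.linearIndependent _ hy hy0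
    obtain ⟨φ, hφ⟩ : ∃ φ : Fin N → Module.Dual k s, ∀ i j, φ i (y j) = if j = i then 1 else 0 := by
      choose φ hφ using fun i ↦ LinearMap.exists_extend (Finsupp.lapply i ∘ₗ hli.repr)
      refine ⟨φ, fun i j ↦ ?_⟩
      have h1 := LinearMap.congr_fun (hφ i) ⟨y j, Submodule.subset_span ⟨j, rfl⟩⟩
      have h2 := hli.repr_eq_single j ⟨y j, Submodule.subset_span ⟨j, rfl⟩⟩ rfl
      simpa [h2, Finsupp.single_apply] using h1
    obtain ⟨C, hC⟩ := hC φ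
    have h1 : C (A y) = Matrix.det (1 : Matrix (Fin N) (Fin N) k) := by
      rw [hA, MultilinearMap.alternatization_apply, map_sum, Matrix.det_apply]
      refine Finset.sum_congr rfl fun σ _ ↦ ?_
      rw [MultilinearMap.domDomCongr_apply]
      have hl (w : Y.carrier) : C (Equiv.Perm.sign σ • w) = Equiv.Perm.sign σ • C w := by
        rcases Int.units_eq_one_or (Equiv.Perm.sign σ) with h | h <;> simp [h]
      rw [hl, hC]
      simp [hφ, Matrix.one_apply]
    rw [h0, map_zero, Matrix.det_one] at h1
    exact zero_ne_one h1
  have hwt : A y ∈ wtSpace k s H Y.carrier (lam + ∑ i, β i) := fun z ↦ by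
    rw [hA, MultilinearMap.lie_alternatization m (hm z (lam z) (hx z)), ← hA]
    have (i : Fin N) : A (Function.update y i ⁅(z : s), y i⁆) = β i z • A y := by
      rw [hy i z, A.map_update_smul, Function.update_eq_self]
    simp only [this]
    rw [← Finset.sum_smul, ← add_smul, add_comm, LinearMap.add_apply, LinearMap.sum_apply]
  have hsing : IsSingular k s H Pos (A y) := fun γ hγ z hz ↦ by
    rw [hA, MultilinearMap.lie_alternatization m (t := 0)
      (hm z 0 (by rw [zero_smul]; exact hBlam.isSingular hPos hx γ hγ z hz)), ← hA, zero_smul,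
      add_zero]
    refine Finset.sum_eq_zero fun i _ ↦ ?_
    have hmem := lie_mem_wtSpace hz (hy i)
    rcases eq_zero_or_isRoot_of_mem hmem with h | h | h
    · rw [h, A.map_update_zero]
    · exact absurd h (hPos.add_ne_zero hγ (AddSubmonoid.subset_closure (hβPos i)))
    · obtain ⟨j, hj⟩ := hideal i γ hγ (by rwa [add_comm])
      rw [add_comm, ← hj] at h hmem
      obtain ⟨t, ht⟩ := exists_smul_eq_of_mem_wtSpace h (hy j) (hy0 j) hmem
      have hij : i ≠ j := by
        rintro rfl
        exact (hPos.1 γ hγ).1 (by simpa using hj)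
      rw [ht, A.map_update_smul, A.map_update_self _ hij, smul_zero]
  obtain ⟨S, i, q, hS, hq⟩ := exists_irreducibleSummand_proj_ne_zero (k := k) (s := s) hA0
  have := hS.irreducible
  have hhw := isHighestWeightOf_of_isSingular hPos (q.apply_mem_wtSpace hwt) hq (hsing.map q)
  exact ⟨⟨S, hS.irreducible, hS.finiteDimensional, hhw⟩, hY S i q hS _ hhw⟩

end Alternating

section Shift

open LieModule

variable {k s} {H} {Pos : Set (Module.Dual k H)}
variable {V : Type u} [AddCommGroup V] [Module k V] [LieRingModule s V] [LieModule k s V]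

variable (H Pos V) in
/-- Translation by `δ` preserves dominant weights and moves each of them within its linkage
class, at every level. -/
def IsShift (δ : Module.Dual k H) : Prop :=
  ∀ lam, IsDominant k s H Pos lam → ∀ a, IsDominant k s H Pos (lam + δ) ∧
    Relation.EqvGen (hwStep k s H Pos V) (lam, a) (lam + δ, a)

theorem IsShift.zero : IsShift H Pos V 0 := fun lam hlam a ↦ by
  rw [add_zero]
  exact ⟨hlam, Relation.EqvGen.refl _⟩

theorem IsShift.add {δ ε : Module.Dual k H} (hδ : IsShift H Pos V δ) (hε : IsShift H Pos V ε) :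
    IsShift H Pos V (δ + ε) := fun lam hlam a ↦ by
  obtain ⟨h1, h2⟩ := hδ lam hlam a
  obtain ⟨h3, h4⟩ := hε _ h1 a
  rw [← add_assoc]
  exact ⟨h3, h2.trans _ _ _ h4⟩

theorem IsShift.sum_of_ideal [FiniteDimensional k V]
    (hPos : IsPositiveSystem k s H Pos) (hV : ∀ x : s, (∀ v : V, ⁅x, v⁆ = 0) → x = 0)
    (I : Finset (Module.Dual k H)) (hI : ∀ β ∈ I, β ∈ Pos)
    (hideal : ∀ β ∈ I, ∀ γ ∈ Pos, β + γ ∈ Pos → β + γ ∈ I) :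
    IsShift H Pos V (∑ β ∈ I, β) := fun lam hlam a ↦ by
  have hsum : ∑ β ∈ I, β = ∑ i, (I.equivFin.symm i : Module.Dual k H) := by
    rw [Equiv.sum_comp I.equivFin.symm (fun β ↦ (β : Module.Dual k H)),
      Finset.sum_coe_sort I fun β ↦ β]
  rw [hsum]
  refine IsLinked.of_ideal hPos hV (fun i ↦ (I.equivFin.symm i : Module.Dual k H))
    (Subtype.val_injective.comp I.equivFin.symm.injective) (fun i ↦ hI _ (I.equivFin.symm i).2)
    (fun i γ hγ h ↦ ?_) hlam a
  have hi := (I.equivFin.symm i).2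
  exact ⟨I.equivFin ⟨_, hideal _ hi γ hγ (hPos.2.2 _ (hI _ hi) γ hγ h)⟩, by simp⟩

theorem IsPositiveSystem.exists_isShift_sub_eq [FiniteDimensional k V]
    (hPos : IsPositiveSystem k s H Pos) (hV : ∀ x : s, (∀ v : V, ⁅x, v⁆ = 0) → x = 0)
    {β : Module.Dual k H} (hβ : β ∈ Pos) :
    ∃ δ ε, IsShift H Pos V δ ∧ IsShift H Pos V ε ∧ β = δ - ε := by
  classical
  have hfin : Pos.Finite :=
    (finite_isWeightOf (k := k) (s := s) (H := H) (M := s)).subset fun χ hχ ↦ (hPos.1 χ hχ).2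
  let I : Finset (Module.Dual k H) :=
    hfin.toFinset.filter fun γ ↦ γ - β ∈ AddSubmonoid.closure Pos
  have hmem (γ : Module.Dual k H) :
      γ ∈ I ↔ γ ∈ Pos ∧ γ - β ∈ AddSubmonoid.closure Pos := by simp [I]
  have hβI : β ∈ I := (hmem β).mpr ⟨hβ, by rw [sub_self]; exact zero_mem _⟩
  have hideal : ∀ γ ∈ I, ∀ γ' ∈ Pos, γ + γ' ∈ Pos → γ + γ' ∈ I := fun γ hγ γ' hγ' h ↦ by
    refine (hmem _).mpr ⟨h, ?_⟩
    rw [add_sub_right_comm]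
    exact add_mem ((hmem γ).mp hγ).2 (AddSubmonoid.subset_closure hγ')
  refine ⟨∑ γ ∈ I, γ, ∑ γ ∈ I.erase β, γ,
    IsShift.sum_of_ideal hPos hV I (fun γ hγ ↦ ((hmem γ).mp hγ).1) hideal,
    IsShift.sum_of_ideal hPos hV _
      (fun γ hγ ↦ ((hmem γ).mp (Finset.mem_of_mem_erase hγ)).1) fun γ hγ γ' hγ' h ↦ ?_, ?_⟩
  · refine Finset.mem_erase.mpr ⟨fun hne ↦ ?_,
      hideal γ (Finset.mem_of_mem_erase hγ) γ' hγ' h⟩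
    refine hPos.add_ne_zero hγ' ((hmem γ).mp (Finset.mem_of_mem_erase hγ)).2 ?_
    rw [← hne]
    abel
  · rw [← Finset.sum_erase_add I (fun γ ↦ γ) hβI, add_sub_cancel_left]

theorem exists_isShift_sub_eq_of_mem_rootLattice [FiniteDimensional k V]
    (hPos : IsPositiveSystem k s H Pos) (hV : ∀ x : s, (∀ v : V, ⁅x, v⁆ = 0) → x = 0)
    {χ : Module.Dual k H} (hχ : χ ∈ rootLattice k s H) :
    ∃ δ ε, IsShift H Pos V δ ∧ IsShift H Pos V ε ∧ χ = δ - ε := by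
  induction hχ using AddSubgroup.closure_induction with
  | mem χ hχ =>
    rcases hPos.mem_or_neg_mem hχ with h | h
    · exact hPos.exists_isShift_sub_eq hV h
    · obtain ⟨δ, ε, hδ, hε, h⟩ := hPos.exists_isShift_sub_eq (V := V) hV h
      exact ⟨ε, δ, hε, hδ, by rw [← neg_sub, ← h, neg_neg]⟩
  | zero => exact ⟨0, 0, IsShift.zero, IsShift.zero, (sub_self 0).symm⟩
  | add χ ψ _ _ hχ hψ =>
    obtain ⟨δ, ε, hδ, hε, rfl⟩ := hχ
    obtain ⟨δ', ε', hδ', hε', rfl⟩ := hψ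
    exact ⟨δ + δ', ε + ε', hδ.add hδ', hε.add hε', by abel⟩
  | neg χ _ hχ =>
    obtain ⟨δ, ε, hδ, hε, rfl⟩ := hχ
    exact ⟨ε, δ, hε, hδ, neg_sub δ ε⟩

theorem eqvGen_of_sub_mem_rootLattice [FiniteDimensional k V]
    (hPos : IsPositiveSystem k s H Pos) (hV : ∀ x : s, (∀ v : V, ⁅x, v⁆ = 0) → x = 0)
    {lam mu : Module.Dual k H} (hlam : IsDominant k s H Pos lam) (hmu : IsDominant k s H Pos mu)
    (h : mu - lam ∈ rootLattice k s H) (a : k) :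
    Relation.EqvGen (hwStep k s H Pos V) (lam, a) (mu, a) := by
  obtain ⟨δ, ε, hδ, hε, h⟩ := exists_isShift_sub_eq_of_mem_rootLattice (V := V) hPos hV h
  have h1 := (hδ lam hlam a).2
  have h2 := (hε mu hmu a).2
  rw [show mu + ε = lam + δ by rw [← sub_eq_zero, ← sub_eq_zero.mpr h]; abel] at h2
  exact h1.trans _ _ _ h2.symm

theorem IsLinked.exists_isDominant {X : Type u} [AddCommGroup X] [Module k X]
    [LieRingModule s X] [LieModule k s X] [FiniteDimensional k X] [Nontrivial X]
    (hPos : IsPositiveSystem k s H Pos) {p : Module.Dual k H × k} {c : k}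
    (h : IsLinked H Pos V p X c) :
    ∃ κ, IsDominant k s H Pos κ ∧ Relation.EqvGen (hwStep k s H Pos V) p (κ, c) := by
  obtain ⟨x, hx⟩ := exists_ne (0 : X)
  obtain ⟨S, i, q, hS, -⟩ := exists_irreducibleSummand_proj_ne_zero (k := k) (s := s) hx
  have := hS.irreducible
  have := hS.finiteDimensional
  obtain ⟨κ, hκ⟩ := exists_isHighestWeightOf (M := S.carrier) hPos
  exact ⟨κ, ⟨S, hS.irreducible, hS.finiteDimensional, hκ⟩, h S i q hS κ hκ⟩

theorem IsDominant.exists_eqvGen_add_int [FiniteDimensional k V] [Nontrivial V]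
    (hPos : IsPositiveSystem k s H Pos) {lam : Module.Dual k H} (hlam : IsDominant k s H Pos lam)
    (a : k) (n : ℤ) :
    ∃ κ, IsDominant k s H Pos κ ∧
      Relation.EqvGen (hwStep k s H Pos V) (lam, a) (κ, a + n) := by
  induction n with
  | zero => exact ⟨lam, hlam, by simpa using Relation.EqvGen.refl _⟩
  | succ n ih =>
    obtain ⟨κ, ⟨B, hB, hBf, hBκ⟩, h⟩ := ih
    have : Nontrivial B.carrier := (LieSubmodule.nontrivial_iff k s B.carrier).mp inferInstance
    obtain ⟨κ', hκ', h'⟩ := ((isLinked_self (V := V) hPos hBκ (a + (n : ℤ))).tensor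
      hPos).exists_isDominant hPos
    refine ⟨κ', hκ', h.trans _ _ _ ?_⟩
    convert h' using 2
    push_cast
    ring
  | pred n ih =>
    obtain ⟨κ, ⟨B, hB, hBf, hBκ⟩, h⟩ := ih
    have : Nontrivial B.carrier := (LieSubmodule.nontrivial_iff k s B.carrier).mp inferInstance
    have h0 := isLinked_self (V := V) hPos hBκ (a + (-n : ℤ))
    rw [show a + ((-n : ℤ) : k) = a + ((-n - 1 : ℤ) : k) + 1 by push_cast; ring] at h h0
    obtain ⟨κ', hκ', h'⟩ := (h0.hom hPos).exists_isDominant hPos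
    exact ⟨κ', hκ', h.trans _ _ _ h'⟩

end Shift

/-- Let `V` be a faithful irreducible finite-dimensional `s`-module with
highest weight `ν`, and let `∼` be the equivalence relation on `P⁺ × k` generated by
`(lam,a) ∼ (mu,a+1)` whenever `Hom_s(V ⊗ M_lam, M_mu) ≠ 0`.  Then `(lam,a) ∼ (mu,b)` iff
there is `n ∈ ℤ` with `mu − lam − nν ∈ Q` and `b = a + n`. -/
theorem eqvGen_hwStep_iff
    (Pos : Set (Module.Dual k ↥H)) (hPos : IsPositiveSystem k s H Pos)
    (V : Type u) [AddCommGroup V] [Module k V] [LieRingModule s V] [LieModule k s V]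
    [FiniteDimensional k V] [LieModule.IsIrreducible k s V]
    (hVfaithful : ∀ x : s, (∀ v : V, ⁅x, v⁆ = 0) → x = 0)
    (ν : Module.Dual k ↥H) (hν : IsHighestWeightOf k s H Pos V ν)
    (lam mu : Module.Dual k ↥H) (a b : k)
    (hlam : IsDominant k s H Pos lam) (hmu : IsDominant k s H Pos mu) :
    Relation.EqvGen (hwStep k s H Pos V) (lam, a) (mu, b) ↔
      ∃ n : ℤ, mu - lam - n • ν ∈ rootLattice k s H ∧ b = a + (n : k) := by
  constructor
  · exact exists_int_of_eqvGen hPos hν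
  · rintro ⟨n, hn, rfl⟩
    have : Nontrivial V := (LieSubmodule.nontrivial_iff k s V).mp inferInstance
    obtain ⟨κ, hκ, h⟩ := hlam.exists_eqvGen_add_int (V := V) hPos a n
    obtain ⟨n', hn', h'⟩ := exists_int_of_eqvGen hPos hν h
    obtain rfl : n = n' := by exact_mod_cast add_left_cancel h'
    refine h.trans _ _ _ (eqvGen_of_sub_mem_rootLattice hPos hVfaithful hκ hmu ?_ _)
    convert sub_mem hn hn' using 1
    abel
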